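/- arXiv:1811.04194 — 4 statements merged into one kernel-verified Lean document; each statement's English description precedes it below -/
import Mathlib

section
/- Let E be a real inner product space and f : E → ℝ differentiable with L-Lipschitz gradient (L > 0). Then for every x, v ∈ E and every step size η > 0, the inexact gradient step x⁺ = x − η·v satisfies f(x⁺) ≤ f(x) + (Lη²/2 − η/2)·‖v‖² + (η/2)·‖∇f(x) − v‖². -/
/-- The descent lemma: a function whose gradient is `L`-Lipschitz lies below its quadratic
upper model. -/
theorem le_add_inner_add_of_lipschitz_gradient
    {E : Type*} [NormedAddCommGroup E] [InnerProductSpace ℝ E]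
    {f : E → ℝ} {f' : E → E} {L : ℝ}
    (hdiff : ∀ x, HasFDerivAt f (innerSL ℝ (f' x)) x)
    (hlip : ∀ x y, ‖f' x - f' y‖ ≤ L * ‖x - y‖) (x d : E) :
    f (x + d) ≤ f x + inner ℝ (f' x) d + L / 2 * ‖d‖ ^ 2 := by
  let φ : ℝ → ℝ := fun t ↦ f (x + t • d) - t * inner ℝ (f' x) d - L / 2 * ‖d‖ ^ 2 * t ^ 2
  have hφ (t : ℝ) : HasDerivAt φ
      (inner ℝ (f' (x + t • d)) d - inner ℝ (f' x) d - L * ‖d‖ ^ 2 * t) t := by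
    have hline : HasDerivAt (fun t : ℝ ↦ x + t • d) d t := by
      simpa using ((hasDerivAt_id t).smul_const d).const_add x
    have hf : HasDerivAt (fun t : ℝ ↦ f (x + t • d)) (inner ℝ (f' (x + t • d)) d) t := by
      exact (hdiff (x + t • d)).comp_hasDerivAt t hline
    refine ((hf.sub ((hasDerivAt_id t).mul_const (inner ℝ (f' x) d))).sub
      ((hasDerivAt_pow 2 t).const_mul (L / 2 * ‖d‖ ^ 2))).congr_deriv ?_
    push_cast
    ring
  have hanti : AntitoneOn φ (Set.Icc 0 1) := by
    refine antitoneOn_of_deriv_nonpos (convex_Icc 0 1)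
      (fun t _ ↦ (hφ t).continuousAt.continuousWithinAt)
      (fun t _ ↦ (hφ t).differentiableAt.differentiableWithinAt) fun t ht ↦ ?_
    have ht0 : 0 ≤ t := (interior_subset ht).1
    rw [(hφ t).deriv, ← inner_sub_left, sub_nonpos]
    calc inner ℝ (f' (x + t • d) - f' x) d
        ≤ ‖f' (x + t • d) - f' x‖ * ‖d‖ := real_inner_le_norm _ _
      _ ≤ L * ‖x + t • d - x‖ * ‖d‖ := by gcongr; exact hlip _ _
      _ = L * ‖d‖ ^ 2 * t := by
        rw [add_sub_cancel_left, norm_smul, Real.norm_of_nonneg ht0]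
        ring
  have h := hanti (Set.left_mem_Icc.2 zero_le_one) (Set.right_mem_Icc.2 zero_le_one) zero_le_one
  simp only [φ, one_smul, zero_smul, add_zero] at h
  linarith

/-- Let `E` be a real inner product space and `f : E → ℝ`
differentiable with `L`-Lipschitz gradient `f'` (`L > 0`). Then for every
`x, v ∈ E` and every step size `η > 0`, the inexact gradient step
`x⁺ = x − η • v` satisfies
`f x⁺ ≤ f x + (L η²/2 − η/2) ‖v‖² + (η/2) ‖∇f(x) − v‖²`. -/
theorem stmt_0
    {E : Type*} [NormedAddCommGroup E] [InnerProductSpace ℝ E]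
    (f : E → ℝ) (f' : E → E) (L : ℝ) (hL : 0 < L)
    (hdiff : ∀ x, HasFDerivAt f (innerSL ℝ (f' x)) x)
    (hlip : ∀ x y, ‖f' x - f' y‖ ≤ L * ‖x - y‖)
    (x v : E) (η : ℝ) (hη : 0 < η) :
    f (x - η • v) ≤ f x + (L * η ^ 2 / 2 - η / 2) * ‖v‖ ^ 2
      + (η / 2) * ‖f' x - v‖ ^ 2 := by
  have h := le_add_inner_add_of_lipschitz_gradient hdiff hlip x (-(η • v))
  rw [← sub_eq_add_neg, inner_neg_right, real_inner_smul_right, norm_neg, norm_smul, mul_pow,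
    Real.norm_of_nonneg hη.le] at h
  rw [norm_sub_sq_real]
  have hgrad : 0 ≤ η / 2 * ‖f' x‖ ^ 2 := by positivity
  linarith
end

section
/- Let E be a real inner product space and f : E → ℝ differentiable with L-Lipschitz gradient (L > 0). Then for every x, v ∈ E, the step x⁺ = x − v/(2L) satisfies f(x⁺) − f(x) ≤ −(1/(4L))·‖∇f(x)‖² + (1/(4L))·‖v − ∇f(x)‖². -/
open Set in
/-- The quadratic upper bound satisfied by a function with `L`-Lipschitz gradient. -/
theorem le_add_inner_add_sq_of_lipschitz_gradient
    {E : Type*} [NormedAddCommGroup E] [InnerProductSpace ℝ E]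
    {f : E → ℝ} {f' : E → E} {L : ℝ}
    (hdiff : ∀ x, HasFDerivAt f (innerSL ℝ (f' x)) x)
    (hlip : ∀ x y, ‖f' x - f' y‖ ≤ L * ‖x - y‖) (x w : E) :
    f (x + w) ≤ f x + inner ℝ (f' x) w + L / 2 * ‖w‖ ^ 2 := by
  have hφ (t : ℝ) : HasDerivAt (fun t : ℝ => f (x + t • w)) (inner ℝ (f' (x + t • w)) w) t := by
    have hline : HasDerivAt (fun t : ℝ => x + t • w) w t := by
      simpa using ((hasDerivAt_id t).smul_const w).const_add x
    exact (hdiff (x + t • w)).comp_hasDerivAt t hline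
  have hB (t : ℝ) : HasDerivAt
      (fun t : ℝ => f x + t * inner ℝ (f' x) w + L / 2 * ‖w‖ ^ 2 * t ^ 2)
      (inner ℝ (f' x) w + L * t * ‖w‖ ^ 2) t := by
    refine ((((hasDerivAt_id t).mul_const (inner ℝ (f' x) w)).const_add (f x)).add
      ((hasDerivAt_pow 2 t).const_mul (L / 2 * ‖w‖ ^ 2))).congr_deriv ?_
    norm_num
    ring
  have key := image_le_of_deriv_right_le_deriv_boundary (a := 0) (b := 1)
    (fun t _ => (hφ t).continuousAt.continuousWithinAt)
    (fun t _ => (hφ t).hasDerivWithinAt) (by simp)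
    (fun t _ => (hB t).continuousAt.continuousWithinAt)
    (fun t _ => (hB t).hasDerivWithinAt)
    (fun t ht => by
      have hgrad : ‖f' (x + t • w) - f' x‖ ≤ L * (t * ‖w‖) := by
        simpa [norm_smul, abs_of_nonneg ht.1] using hlip (x + t • w) x
      have hinner := real_inner_le_norm (f' (x + t • w) - f' x) w
      rw [inner_sub_left] at hinner
      nlinarith [mul_le_mul_of_nonneg_right hgrad (norm_nonneg w)])
    (right_mem_Icc.2 zero_le_one)
  simpa using key


/-- Let `E` be a real inner product space and `f : E → ℝ`
differentiable with `L`-Lipschitz gradient `f'` (`L > 0`). Then for every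
`x, v ∈ E`, the step `x⁺ = x − v/(2L)` satisfies
`f x⁺ − f x ≤ −(1/(4L)) ‖∇f(x)‖² + (1/(4L)) ‖v − ∇f(x)‖²`. -/
theorem stmt_2
    {E : Type*} [NormedAddCommGroup E] [InnerProductSpace ℝ E]
    (f : E → ℝ) (f' : E → E) (L : ℝ) (hL : 0 < L)
    (hdiff : ∀ x, HasFDerivAt f (innerSL ℝ (f' x)) x)
    (hlip : ∀ x y, ‖f' x - f' y‖ ≤ L * ‖x - y‖)
    (x v : E) :
    f (x - (1 / (2 * L)) • v) - f x
      ≤ -(1 / (4 * L)) * ‖f' x‖ ^ 2 + (1 / (4 * L)) * ‖v - f' x‖ ^ 2 := by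
  have hdescent := le_add_inner_add_sq_of_lipschitz_gradient hdiff hlip x (-((1 / (2 * L)) • v))
  rw [← sub_eq_add_neg, inner_neg_right, real_inner_smul_right, norm_neg, norm_smul, mul_pow,
    Real.norm_eq_abs, sq_abs] at hdescent
  have hquad : L / 2 * ((1 / (2 * L)) ^ 2 * ‖v‖ ^ 2) = 1 / (8 * L) * ‖v‖ ^ 2 := by
    field_simp
    ring
  have hcoeff : 1 / (8 * L) * ‖v‖ ^ 2 ≤ 1 / (4 * L) * ‖v‖ ^ 2 := by
    gcongr
    norm_num
  have hhalf : 1 / (2 * L) = 2 * (1 / (4 * L)) := by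
    field_simp
    norm_num
  rw [hquad, hhalf] at hdescent
  rw [norm_sub_sq_real, real_inner_comm, hhalf]
  linarith
end

section
/- Let E be a real inner product space and f : E → ℝ differentiable with L-Lipschitz gradient (L > 0). Then for every x, v ∈ E, the step x⁺ = x − v/(2L) satisfies f(x⁺) − f(x) ≤ −(1/(8L))·‖v‖² + (1/L)·‖v − ∇f(x)‖². -/
/-- Let `E` be a real inner product space and `f : E → ℝ`
differentiable with `L`-Lipschitz gradient `f'` (`L > 0`). Then for every
`x, v ∈ E`, the step `x⁺ = x − v/(2L)` satisfies
`f x⁺ − f x ≤ −(1/(8L)) ‖v‖² + (1/L) ‖v − ∇f(x)‖²`. -/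
theorem stmt_3
    {E : Type*} [NormedAddCommGroup E] [InnerProductSpace ℝ E]
    (f : E → ℝ) (f' : E → E) (L : ℝ) (hL : 0 < L)
    (hdiff : ∀ x, HasFDerivAt f (innerSL ℝ (f' x)) x)
    (hlip : ∀ x y, ‖f' x - f' y‖ ≤ L * ‖x - y‖)
    (x v : E) :
    f (x - (1 / (2 * L)) • v) - f x
      ≤ -(1 / (8 * L)) * ‖v‖ ^ 2 + (1 / L) * ‖v - f' x‖ ^ 2 := by
  have hdescent := le_add_inner_add_of_lipschitz_gradient hdiff hlip x (-((1 / (2 * L)) • v))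
  rw [← sub_eq_add_neg, inner_neg_right, real_inner_smul_right, norm_neg, norm_smul,
    Real.norm_of_nonneg (by positivity)] at hdescent
  have hsub := norm_sub_sq_real v (f' x)
  rw [real_inner_comm] at hsub
  have hbound : -(1 / (2 * L) * inner ℝ (f' x) v) + L / 2 * (1 / (2 * L) * ‖v‖) ^ 2
      ≤ -(1 / (8 * L)) * ‖v‖ ^ 2 + (1 / L) * ‖v - f' x‖ ^ 2 := by
    have hkey : 0 ≤ ‖v - f' x‖ ^ 2 + inner ℝ (f' x) v / 2 - ‖v‖ ^ 2 / 4 := by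
      linarith [sq_nonneg ‖f' x‖, sq_nonneg ‖v - f' x‖]
    have hdiv : 0 ≤ 1 / L * (‖v - f' x‖ ^ 2 + inner ℝ (f' x) v / 2 - ‖v‖ ^ 2 / 4) := by
      positivity
    have heq : L / 2 * (1 / (2 * L) * ‖v‖) ^ 2 = 1 / L * (‖v‖ ^ 2 / 8) := by
      field_simp
      ring
    rw [heq]
    have h2 : 1 / (2 * L) = 1 / L / 2 := by field_simp
    have h8 : 1 / (8 * L) = 1 / L / 8 := by field_simp
    rw [h2, h8]
    linarith
  linarith
end

section
/- Let E be a real inner product space, n ≥ 1, and f_1, …, f_n : E → ℝ differentiable functions each with L-Lipschitz gradient. Let f = (1/n)·Σ_{i=1}^n f_i. Then for all x, y ∈ E, (1/n)·Σ_{i=1}^n ‖(∇f_i(x) − ∇f_i(y)) − (∇f(x) − ∇f(y))‖² ≤ L²·‖x − y‖². -/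
/-- The sum of squared distances to the mean is at most the sum of squared norms. -/
theorem sum_norm_sub_sq_le_of_card_smul_eq_sum {ι E : Type*} [NormedAddCommGroup E]
    [InnerProductSpace ℝ E] (s : Finset ι) (v : ι → E) (m : E)
    (hm : (s.card : ℝ) • m = ∑ i ∈ s, v i) :
    ∑ i ∈ s, ‖v i - m‖ ^ 2 ≤ ∑ i ∈ s, ‖v i‖ ^ 2 := by
  have hinner : ∑ i ∈ s, inner ℝ (v i) m = s.card * ‖m‖ ^ 2 := by
    rw [← sum_inner, ← hm, real_inner_smul_left, real_inner_self_eq_norm_sq]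
  simp only [norm_sub_sq_real, Finset.sum_add_distrib, Finset.sum_sub_distrib,
    ← Finset.mul_sum, hinner, Finset.sum_const, nsmul_eq_mul]
  have : 0 ≤ (s.card : ℝ) * ‖m‖ ^ 2 := by positivity
  linarith

/-- A gradient of `c * ∑ i, f i` is `c` times the sum of the gradients. -/
theorem eq_smul_sum_of_hasFDerivAt_innerSL {ι E : Type*} [Fintype ι] [NormedAddCommGroup E]
    [InnerProductSpace ℝ E] {f : ι → E → ℝ} {g : ι → E} {G : E} {c : ℝ} {x : E}
    (hf : ∀ i, HasFDerivAt (f i) (innerSL ℝ (g i)) x)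
    (hG : HasFDerivAt (fun z => c * ∑ i, f i z) (innerSL ℝ G) x) :
    G = c • ∑ i, g i := by
  have h := hG.unique ((HasFDerivAt.fun_sum fun i _ => hf i).const_mul c)
  refine ext_inner_right ℝ fun w => ?_
  simpa [sum_inner, real_inner_smul_left] using congrArg (fun φ => φ w) h

/-- Let `E` be a real inner product space, `n ≥ 1`, and
`f_1, …, f_n : E → ℝ` differentiable functions with `L`-Lipschitz gradients
`f'_i`. Let `f = (1/n) Σ_i f_i`, with gradient `F'`. Then for all `x, y`,
`(1/n) Σ_i ‖(∇f_i(x) − ∇f_i(y)) − (∇f(x) − ∇f(y))‖² ≤ L² ‖x − y‖²`. -/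
theorem stmt_14
    {E : Type*} [NormedAddCommGroup E] [InnerProductSpace ℝ E]
    (n : ℕ) (hn : 1 ≤ n) (f : Fin n → E → ℝ) (f' : Fin n → E → E)
    (L : ℝ) (hL : 0 < L)
    (hdiff : ∀ i x, HasFDerivAt (f i) (innerSL ℝ (f' i x)) x)
    (hlip : ∀ i x y, ‖f' i x - f' i y‖ ≤ L * ‖x - y‖)
    (F' : E → E)
    (hF' : ∀ x, HasFDerivAt (fun z => (n : ℝ)⁻¹ * ∑ i, f i z)
      (innerSL ℝ (F' x)) x)
    (x y : E) :
    (n : ℝ)⁻¹ * ∑ i, ‖(f' i x - f' i y) - (F' x - F' y)‖ ^ 2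
      ≤ L ^ 2 * ‖x - y‖ ^ 2 := by
  have hn0 : (n : ℝ) ≠ 0 := by positivity
  have hmean : ∀ z, (n : ℝ) • F' z = ∑ i, f' i z := fun z => by
    rw [eq_smul_sum_of_hasFDerivAt_innerSL (fun i => hdiff i z) (hF' z), smul_inv_smul₀ hn0]
  calc (n : ℝ)⁻¹ * ∑ i, ‖(f' i x - f' i y) - (F' x - F' y)‖ ^ 2
      ≤ (n : ℝ)⁻¹ * ∑ i, ‖f' i x - f' i y‖ ^ 2 := by
        refine mul_le_mul_of_nonneg_left ?_ (by positivity)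
        apply sum_norm_sub_sq_le_of_card_smul_eq_sum
        simp [smul_sub, hmean]
    _ ≤ (n : ℝ)⁻¹ * ∑ _i : Fin n, (L * ‖x - y‖) ^ 2 := by
        gcongr with i
        exact hlip i x y
    _ = L ^ 2 * ‖x - y‖ ^ 2 := by
        simp only [Finset.sum_const, Finset.card_univ, Fintype.card_fin, nsmul_eq_mul]
        rw [inv_mul_cancel_left₀ hn0, mul_pow]
end
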